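/- arXiv:1210.0257 — 5 statements merged into one kernel-verified Lean document; each statement's English description precedes it below -/
import Mathlib

section
/- Let G be a finite connected simple graph and let Q be a nonempty dominating set of G such that the subgraph of G induced by Q has at most ρ connected components (ρ ≥ 1). Then there exists a set Z ⊆ V(G) of size at most 2(ρ−1) such that Q ∪ Z is a connected dominating set of G, i.e., Q ∪ Z is a dominating set of G and the subgraph of G induced by Q ∪ Z is connected. -/
/-- Merging step: two extra vertices strictly reduce the number of components. -/
theorem merge_step {V : Type*} [Fintype V] (G : SimpleGraph V) (hG : G.Connected)
    (Q : Set V) (hQdom : ∀ v : V, v ∈ Q ∨ ∃ u ∈ Q, G.Adj u v)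
    (hnot : ¬ (G.induce Q).Preconnected) :
    ∃ a b : V, Nat.card (G.induce (Q ∪ {a, b})).ConnectedComponent <
      Nat.card (G.induce Q).ConnectedComponent := by
  classical
  have hd : ∀ v : V, ∃ u : Q, (u : V) = v ∨ (v ∉ Q ∧ G.Adj u v) := by
    intro v
    by_cases hv : v ∈ Q
    · exact ⟨⟨v, hv⟩, Or.inl rfl⟩
    · rcases hQdom v with h | ⟨u, hu, h⟩
      · exact absurd h hv
      · exact ⟨⟨u, hu⟩, Or.inr ⟨hv, h⟩⟩
  choose d hd using hd
  have hdQ : ∀ v : Q, d v = v := by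
    intro v
    rcases hd v with h | h
    · exact Subtype.ext h
    · exact absurd v.2 h.1
  have hedge : ∃ a b, G.Adj a b ∧ ¬ (G.induce Q).Reachable (d a) (d b) := by
    by_contra! hcon
    apply hnot
    have key : ∀ x y : V, ∀ p : G.Walk x y, (G.induce Q).Reachable (d x) (d y) := by
      intro x y p
      induction p with
      | nil => exact SimpleGraph.Reachable.refl _
      | cons h p ih => exact (hcon _ _ h).trans ih
    intro x y
    obtain ⟨p⟩ := hG.preconnected (x : V) y
    have := key _ _ p
    rwa [hdQ, hdQ] at this
  obtain ⟨a, b, hab, hnr⟩ := hedge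
  refine ⟨a, b, ?_⟩
  have hsub : Q ⊆ Q ∪ {a, b} := Set.subset_union_left
  let φ : G.induce Q →g G.induce (Q ∪ {a, b}) := (SimpleGraph.induceHomOfLE G hsub).toHom
  have hφ : ∀ u : (Q ∪ {a, b} : Set V), (G.induce (Q ∪ {a, b})).Reachable (φ (d u)) u := by
    intro u
    rcases hd u with h | h
    · have : φ (d u) = u := Subtype.ext h
      rw [this]
    · apply SimpleGraph.Adj.reachable
      exact h.2
  have hsurj : Function.Surjective (SimpleGraph.ConnectedComponent.map φ) := by
    intro c
    induction c using SimpleGraph.ConnectedComponent.ind with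
    | h u =>
      refine ⟨(G.induce Q).connectedComponentMk (d u), ?_⟩
      exact SimpleGraph.ConnectedComponent.sound (hφ u)
  have hninj : ¬ Function.Injective (SimpleGraph.ConnectedComponent.map φ) := by
    intro hinj
    apply hnr
    apply SimpleGraph.ConnectedComponent.exact
    apply hinj
    apply SimpleGraph.ConnectedComponent.sound
    have ha := hφ ⟨a, by simp⟩
    have hb := hφ ⟨b, by simp⟩
    have hadj : (G.induce (Q ∪ {a, b})).Adj ⟨a, by simp⟩ ⟨b, by simp⟩ := hab
    exact ha.trans (hadj.reachable.trans hb.symm)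
  have hle := Nat.card_le_card_of_surjective _ hsurj
  refine lt_of_le_of_ne hle fun heq => hninj ?_
  exact ((Nat.bijective_iff_surjective_and_card _).2 ⟨hsurj, heq.symm⟩).1


/-- Let `G` be a finite connected simple graph and let `Q` be a nonempty dominating set of `G`
such that the subgraph of `G` induced by `Q` has at most `ρ` connected components (`ρ ≥ 1`).
Then there exists a set `Z ⊆ V(G)` of size at most `2(ρ−1)` such that `Q ∪ Z` is a connected
dominating set of `G`. -/
theorem connected_dominating_set_of_dominating_components
    {V : Type*} [Fintype V] (G : SimpleGraph V) (hG : G.Connected)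
    (Q : Set V) (hQne : Q.Nonempty)
    (hQdom : ∀ v : V, v ∈ Q ∨ ∃ u ∈ Q, G.Adj u v)
    (ρ : ℕ) (hρ : 1 ≤ ρ)
    (hcomp : Nat.card (G.induce Q).ConnectedComponent ≤ ρ) :
    ∃ Z : Set V, Z.ncard ≤ 2 * (ρ - 1) ∧
      (∀ v : V, v ∈ Q ∪ Z ∨ ∃ u ∈ Q ∪ Z, G.Adj u v) ∧
      (G.induce (Q ∪ Z)).Connected := by
  induction ρ, hρ using Nat.le_induction generalizing Q with
  | base =>
    refine ⟨∅, by simp, by simpa using hQdom, ?_⟩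
    rw [Set.union_empty]
    have : Nonempty Q := hQne.to_subtype
    refine ⟨?_⟩
    by_contra hnot
    obtain ⟨a, b, h⟩ := merge_step G hG Q hQdom hnot
    have hne : Nonempty (Q ∪ {a, b} : Set V) := ⟨⟨a, by simp⟩⟩
    have : Nonempty (G.induce (Q ∪ {a, b})).ConnectedComponent :=
      hne.map (G.induce (Q ∪ {a, b})).connectedComponentMk
    have := Nat.card_pos (α := (G.induce (Q ∪ {a, b})).ConnectedComponent)
    omega
  | succ n hn ih =>
    by_cases hpre : (G.induce Q).Preconnected
    · refine ⟨∅, by simp, by simpa using hQdom, ?_⟩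
      rw [Set.union_empty]
      have : Nonempty Q := hQne.to_subtype
      exact ⟨hpre⟩
    · obtain ⟨a, b, h⟩ := merge_step G hG Q hQdom hpre
      obtain ⟨Z, hZ, hdom, hconn⟩ := ih (Q ∪ {a, b}) (hQne.mono Set.subset_union_left)
        (fun v => (hQdom v).imp Or.inl fun ⟨u, hu, h⟩ => ⟨u, Or.inl hu, h⟩) (by omega)
      rw [Set.union_assoc] at hdom hconn
      refine ⟨{a, b} ∪ Z, ?_, hdom, hconn⟩
      have h1 := Set.ncard_union_le {a, b} Z
      have h2 := Set.ncard_insert_le a {b}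
      rw [Set.ncard_singleton] at h2
      omega
end

section
/- Let T be a finite tree with at least two vertices. Let P_2(T) denote the set of maximal paths of T consisting of link nodes, i.e., the connected components of the subgraph of T induced by the set S_2(T) of degree-2 vertices. Then |P_2(T)| ≤ 2|L(T)| − 1, where L(T) is the set of leaves of T. -/
theorem aux_parent {V : Type*} (T : SimpleGraph V) (hT : T.IsTree) :
    ∃ (par : V → V) (f : V → ℕ), ∀ v w, T.Adj v w → w ≠ par v → par w = v ∧ f w = f v + 1 := by
  classical
  obtain ⟨r⟩ := hT.connected.nonempty
  choose p hp hu using fun v => hT.existsUnique_path v r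
  refine ⟨fun v => (p v).snd, fun v => (p v).length, fun v w h hne => ?_⟩
  have hw : w ∉ (p v).support := fun hm =>
    hne (hT.isAcyclic.eq_snd_of_adj_start (hp v) h hm)
  have hpath : (SimpleGraph.Walk.cons h.symm (p v)).IsPath := (hp v).cons hw
  have he := hu w _ hpath
  beta_reduce
  rw [← he]
  simp

theorem aux_count {V : Type*} [Fintype V] (T : SimpleGraph V) [DecidableRel T.Adj]
    (hT : T.IsTree) (hV : 2 ≤ Fintype.card V) :
    {v : V | T.degree v ≠ 2}.ncard + 2 ≤ 2 * {v : V | T.degree v = 1}.ncard := by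
  classical
  have : Nontrivial V := Fintype.one_lt_card_iff_nontrivial.mp hV
  have h1 := T.sum_degrees_eq_twice_card_edges
  have h2 := hT.card_edgeFinset
  have h3 : ∑ v, (2 + if T.degree v ≠ 2 then 1 else 0)
      ≤ ∑ v, (T.degree v + 2 * if T.degree v = 1 then 1 else 0) := by
    apply Finset.sum_le_sum
    intro v _
    have := hT.connected.preconnected.degree_pos_of_nontrivial v
    split_ifs <;> omega
  rw [Finset.sum_add_distrib, Finset.sum_add_distrib, ← Finset.mul_sum, ← Finset.card_filter,
    ← Finset.card_filter, Finset.sum_const, Finset.card_univ, smul_eq_mul] at h3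
  rw [Set.ncard_eq_toFinset_card', Set.ncard_eq_toFinset_card', Set.toFinset_ofPred,
    Set.toFinset_ofPred]
  omega

theorem aux_inj {V : Type*} [Fintype V] (T : SimpleGraph V) [DecidableRel T.Adj]
    (hT : T.IsTree) :
    Nat.card (T.induce {v : V | T.degree v = 2}).ConnectedComponent ≤
      {v : V | T.degree v ≠ 2}.ncard := by
  classical
  obtain ⟨par, f, hpf⟩ := aux_parent T hT
  have key : ∀ C : (T.induce {v : V | T.degree v = 2}).ConnectedComponent,
      ∃ w : {v : V | T.degree v ≠ 2}, ∃ h : par w ∈ {v : V | T.degree v = 2},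
        (T.induce {v : V | T.degree v = 2}).connectedComponentMk ⟨par w, h⟩ = C := by
    intro C
    obtain ⟨v, hv, hmax⟩ := Set.exists_max_image C.supp (fun v => f v.1) (Set.toFinite _)
      C.nonempty_supp
    have hd : T.degree v.1 = 2 := v.2
    obtain ⟨w, hw, hne⟩ := Finset.exists_mem_ne
      (s := T.neighborFinset v.1) (by rw [T.card_neighborFinset_eq_degree]; omega) (par v.1)
    rw [T.mem_neighborFinset] at hw
    obtain ⟨h1, h2⟩ := hpf _ _ hw hne
    refine ⟨⟨w, fun hw2 => ?_⟩, ?_⟩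
    · have hadj : (T.induce {v : V | T.degree v = 2}).Adj v ⟨w, hw2⟩ := hw
      have := hmax ⟨w, hw2⟩ (C.mem_supp_of_adj_mem_supp hv hadj)
      simp only at this
      omega
    · simp only [h1]
      exact ⟨v.2, hv⟩
  choose g hg hgC using key
  have hinj : Function.Injective g := by
    intro C D h
    rw [← hgC C, ← hgC D]
    simp only [h]
  rw [← Nat.card_coe_set_eq]
  exact Nat.card_le_card_of_injective g hinj

/-- In a finite tree `T` with at least two vertices, the number of maximal paths consisting of
link nodes (i.e., connected components of the subgraph induced by degree-2 vertices) is at most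
`2 |L(T)| − 1`, where `L(T)` is the set of leaves of `T`. -/
theorem link_paths_le_two_mul_leaves_sub_one
    {V : Type*} [Fintype V] (T : SimpleGraph V) [DecidableRel T.Adj]
    (hT : T.IsTree) (hV : 2 ≤ Fintype.card V) :
    Nat.card (T.induce {v : V | T.degree v = 2}).ConnectedComponent ≤
      2 * {v : V | T.degree v = 1}.ncard - 1 := by
  have h1 := aux_inj T hT
  have h2 := aux_count T hT hV
  omega
end

section
/- Let T be a finite tree with at least two vertices. Let P_2(T) denote the set of maximal paths of T consisting of link nodes, i.e., the connected components of the subgraph of T induced by the set S_2(T) of degree-2 vertices. Then |P_2(T)| ≤ |L(T)| + |S_{≥3}(T)|, where L(T) is the set of leaves of T and S_{≥3}(T) is the set of branch nodes of T. -/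
/-- In a tree, a vertex has at most one neighbour closer to the root `r`. -/
lemma parent_unique {V : Type*} {T : SimpleGraph V} (hT : T.IsTree) (r : V) {v v' w : V}
    (h : T.Adj v w) (h' : T.Adj v' w) (hd : T.dist r w = T.dist r v + 1)
    (hd' : T.dist r w = T.dist r v' + 1) : v = v' := by
  obtain ⟨p, hp⟩ := hT.connected.exists_walk_length_eq_dist r v
  obtain ⟨p', hp'⟩ := hT.connected.exists_walk_length_eq_dist r v'
  have h1 : (p.concat h).IsPath :=
    SimpleGraph.Walk.isPath_of_length_eq_dist _ (by simp [hp, hd])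
  have h2 : (p'.concat h').IsPath :=
    SimpleGraph.Walk.isPath_of_length_eq_dist _ (by simp [hp', hd'])
  have h3 : p.concat h = p'.concat h' := (hT.existsUnique_path r w).unique h1 h2
  have h4 := congrArg SimpleGraph.Walk.penultimate h3
  simpa using h4

/-- In a tree, every vertex of degree two has a neighbour farther from the root `r`. -/
lemma exists_child {V : Type*} [Fintype V] {T : SimpleGraph V} [DecidableRel T.Adj]
    (hT : T.IsTree) (r : V) {v : V} (hv : T.degree v = 2) :
    ∃ w, T.Adj v w ∧ T.dist r w = T.dist r v + 1 := by
  obtain ⟨a, ha, b, hb, hab⟩ := Finset.one_lt_card.1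
    (show 1 < (T.neighborFinset v).card by rw [T.card_neighborFinset_eq_degree, hv]; norm_num)
  rw [SimpleGraph.mem_neighborFinset] at ha hb
  rcases hT.dist_eq_dist_add_one_of_adj r ha with h1 | h1
  · rcases hT.dist_eq_dist_add_one_of_adj r hb with h2 | h2
    · exact absurd (parent_unique hT r ha.symm hb.symm h1 h2) hab
    · exact ⟨b, hb, h2⟩
  · exact ⟨a, ha, h1⟩

/-- In a finite tree `T` with at least two vertices, the number of maximal paths consisting of
link nodes (i.e., connected components of the subgraph induced by degree-2 vertices) is at most
`|L(T)| + |S_{≥3}(T)|`, where `L(T)` is the set of leaves and `S_{≥3}(T)` the set of branch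
nodes of `T`. -/
theorem link_paths_le_leaves_add_branch
    {V : Type*} [Fintype V] (T : SimpleGraph V) [DecidableRel T.Adj]
    (hT : T.IsTree) (hV : 2 ≤ Fintype.card V) :
    Nat.card (T.induce {v : V | T.degree v = 2}).ConnectedComponent ≤
      {v : V | T.degree v = 1}.ncard + {v : V | 3 ≤ T.degree v}.ncard := by
  classical
  have hnt : Nontrivial V := Fintype.one_lt_card_iff_nontrivial.1 hV
  obtain ⟨r⟩ := hT.connected.nonempty
  have key : ∀ C : (T.induce {v : V | T.degree v = 2}).ConnectedComponent,
      ∃ (v : {v : V | T.degree v = 2}) (w : V),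
        (T.induce {v : V | T.degree v = 2}).connectedComponentMk v = C ∧
        T.Adj v w ∧ T.dist r w = T.dist r v + 1 ∧ T.degree w ≠ 2 := by
    intro C
    obtain ⟨v, hvC, hmax⟩ := Set.exists_max_image C.supp (fun x => T.dist r x)
      (Set.toFinite _) C.nonempty_supp
    obtain ⟨w, hvw, hd⟩ := exists_child hT r v.2
    refine ⟨v, w, hvC, hvw, hd, fun hw => ?_⟩
    have hadj : (T.induce {v : V | T.degree v = 2}).Adj v ⟨w, hw⟩ := hvw
    have hwC : (⟨w, hw⟩ : {v : V | T.degree v = 2}) ∈ C.supp :=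
      (SimpleGraph.ConnectedComponent.connectedComponentMk_eq_of_adj hadj).symm.trans hvC
    have := hmax _ hwC
    simp only at this
    omega
  choose f g hf hfg hd hg using key
  have hinj : Function.Injective g := by
    intro C D h
    have h1 : (f C : V) = f D :=
      parent_unique hT r (hfg C) (h ▸ hfg D) (hd C) (by rw [h]; exact hd D)
    rw [← hf C, ← hf D, Subtype.ext h1]
  have hmem : Set.range g ⊆ {v : V | T.degree v = 1} ∪ {v : V | 3 ≤ T.degree v} := by
    rintro _ ⟨C, rfl⟩
    have h0 := hT.connected.preconnected.degree_pos_of_nontrivial (g C)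
    have h2 := hg C
    simp only [Set.mem_union, Set.mem_setOf_eq]
    omega
  calc _ = (Set.range g).ncard := by
        rw [← Set.image_univ, Set.ncard_image_of_injective _ hinj, Set.ncard_univ]
    _ ≤ _ := Set.ncard_le_ncard hmem (Set.toFinite _)
    _ ≤ _ := Set.ncard_union_le _ _
end

section
/- Let A and B be types and let P : A → B → ℤ → Prop be a predicate such that P H F k is false whenever k < 0. Define a relation ≡ on A by: H₁ ≡ H₂ if and only if there exists a constant c ∈ ℤ such that for all F ∈ B and all k ∈ ℤ, P H₁ F k holds if and only if P H₂ F (k + c) holds. Then every equivalence class C of ≡ contains a progressive representative, i.e., an element J ∈ C such that for every H ∈ C there exists a constant c ≤ 0 with the property that for all F ∈ B and all k ∈ ℤ, P H F k holds if and only if P J F (k + c) holds. -/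
/-- Let `P : A → B → ℤ → Prop` be a predicate that is false on negative parameters, and consider
the equivalence relation `H₁ ≡ H₂ ↔ ∃ c : ℤ, ∀ F k, P H₁ F k ↔ P H₂ F (k + c)`. Every
equivalence class contains a progressive representative: for every `H₀ : A` there is a `J`
equivalent to `H₀` such that every `H` equivalent to `H₀` translates to `J` with a nonpositive
constant `c`. -/
theorem exists_progressive_representative
    {A B : Type*} (P : A → B → ℤ → Prop)
    (hP : ∀ (H : A) (F : B) (k : ℤ), k < 0 → ¬ P H F k)
    (H₀ : A) :
    ∃ J : A, (∃ c : ℤ, ∀ (F : B) (k : ℤ), P H₀ F k ↔ P J F (k + c)) ∧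
      ∀ H : A, (∃ c : ℤ, ∀ (F : B) (k : ℤ), P H₀ F k ↔ P H F (k + c)) →
        ∃ c : ℤ, c ≤ 0 ∧ ∀ (F : B) (k : ℤ), P H F k ↔ P J F (k + c) := by
  by_cases hE : ∃ F k, P H₀ F k
  · obtain ⟨F₀, k₀, h₀⟩ := hE
    obtain ⟨m, ⟨J, hJ⟩, hm⟩ := Int.exists_least_of_bdd
      (P := fun c : ℤ => ∃ J : A, ∀ (F : B) (k : ℤ), P H₀ F k ↔ P J F (k + c))
      ⟨-k₀, by
        rintro c ⟨J, hJ⟩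
        by_contra hc
        exact hP J F₀ (k₀ + c) (by omega) ((hJ F₀ k₀).1 h₀)⟩
      ⟨0, H₀, by simp⟩
    refine ⟨J, ⟨m, hJ⟩, ?_⟩
    rintro H ⟨c, hc⟩
    have hmc := hm c ⟨H, hc⟩
    refine ⟨m - c, by omega, fun F k => ?_⟩
    have h1 := hc F (k - c)
    have h2 := hJ F (k - c)
    rw [show k - c + c = k by ring] at h1
    rw [show k - c + m = k + (m - c) by ring] at h2
    exact h1.symm.trans h2
  · push Not at hE
    refine ⟨H₀, ⟨0, by simp⟩, ?_⟩
    rintro H ⟨c, hc⟩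
    refine ⟨0, le_rfl, fun F k => ?_⟩
    have h1 := hc F (k - c)
    rw [show k - c + c = k by ring] at h1
    exact ⟨fun h => absurd (h1.2 h) (hE _ _), fun h => absurd h (hE _ _)⟩
end

section
/- Let T be a finite tree, let h ∈ ℕ, and let f be a monotone function from vertex subsets of T to ℕ, i.e., S ⊆ S′ implies f(S) ≤ f(S′). For an edge e = uv of T, let T_u and T_v denote the vertex sets of the two connected components of T − e containing u and v respectively. Call an edge e = uv of T heavy if f(T_u) ≥ h + 1 and f(T_v) ≥ h + 1. Then the subgraph of T formed by the heavy edges together with their endpoints is connected, i.e., the heavy edges form a subtree of T. -/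
theorem heavy_aux {V : Type*} (T : SimpleGraph V) (hT : T.IsAcyclic)
    (h : ℕ) (f : Set V → ℕ) (hf : Monotone f) {a a' x y : V} (haa : T.Adj a a')
    (h1 : h + 1 ≤ f {w : V | (T.deleteEdges {s(a, a')}).Reachable a w})
    (h2 : h + 1 ≤ f {w : V | (T.deleteEdges {s(a, a')}).Reachable a' w})
    (hne : s(a, a') ≠ s(x, y)) (hx : (T.deleteEdges {s(x, y)}).Reachable x a) :
    h + 1 ≤ f {w : V | (T.deleteEdges {s(x, y)}).Reachable x w} := by
  classical
  have key : ∀ c, (T.deleteEdges {s(x, y)}).Reachable x c →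
      ¬ (T.deleteEdges {s(a, a')}).Reachable c x →
      h + 1 ≤ f {w : V | (T.deleteEdges {s(a, a')}).Reachable c w} →
      h + 1 ≤ f {w : V | (T.deleteEdges {s(x, y)}).Reachable x w} := by
    intro c hxc hcx hfc
    refine hfc.trans (hf ?_)
    rintro w ⟨p⟩
    refine hxc.trans ?_
    have hle : T.deleteEdges {s(a, a')} ≤ T := SimpleGraph.deleteEdges_le _
    have hxp : x ∉ (p.mapLe hle).support := by
      intro hm
      rw [SimpleGraph.Walk.support_mapLe_eq_support] at hm
      exact hcx ⟨p.takeUntil x hm⟩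
    exact ⟨(p.mapLe hle).toDeleteEdge s(x, y)
      (fun he => hxp (SimpleGraph.Walk.fst_mem_support_of_mem_edges _ he))⟩
  have hbr : ¬ (T.deleteEdges {s(a, a')}).Reachable a a' := by
    have := SimpleGraph.isAcyclic_iff_forall_adj_isBridge.1 hT haa
    exact SimpleGraph.isBridge_iff.1 this
  have hadj : (T.deleteEdges {s(x, y)}).Adj a a' := by
    rw [SimpleGraph.deleteEdges_adj]
    exact ⟨haa, by simpa using hne⟩
  by_cases hax : (T.deleteEdges {s(a, a')}).Reachable a x
  · exact key a' (hx.trans hadj.reachable) (fun h' => hbr (hax.trans h'.symm)) h2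
  · exact key a hx hax h1

/-- Let `T` be a finite tree, `h : ℕ`, and `f` a monotone function from vertex subsets of `T`
to `ℕ`. An edge `uv` of `T` is heavy if `f` evaluates to at least `h + 1` on the vertex sets of
both connected components of `T − uv`. Then the subgraph of `T` formed by the heavy edges
together with their endpoints is connected. -/
theorem heavy_edges_form_subtree
    {V : Type*} [Fintype V] (T : SimpleGraph V) (hT : T.IsTree)
    (h : ℕ) (f : Set V → ℕ) (hf : Monotone f)
    (H : SimpleGraph V)
    (hH : H = SimpleGraph.fromEdgeSet {e : Sym2 V | ∃ u v : V, e = s(u, v) ∧ T.Adj u v ∧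
        h + 1 ≤ f {w : V | (T.deleteEdges {s(u, v)}).Reachable u w} ∧
        h + 1 ≤ f {w : V | (T.deleteEdges {s(u, v)}).Reachable v w}}) :
    ∀ a ∈ H.support, ∀ b ∈ H.support, H.Reachable a b := by
  classical
  have hadj : ∀ u v, H.Adj u v ↔ T.Adj u v ∧
        h + 1 ≤ f {w : V | (T.deleteEdges {s(u, v)}).Reachable u w} ∧
        h + 1 ≤ f {w : V | (T.deleteEdges {s(u, v)}).Reachable v w} := by
    intro u v
    rw [hH, SimpleGraph.fromEdgeSet_adj]
    constructor
    · rintro ⟨⟨u', v', he, h1, h2, h3⟩, -⟩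
      rcases Sym2.eq_iff.1 he with ⟨rfl, rfl⟩ | ⟨rfl, rfl⟩
      · exact ⟨h1, h2, h3⟩
      · rw [Sym2.eq_swap] at h2 h3
        exact ⟨h1.symm, h3, h2⟩
    · intro h'
      exact ⟨⟨u, v, rfl, h'⟩, h'.1.ne⟩
  have main : ∀ (a b : V) (p : T.Walk a b), p.IsPath → a ∈ H.support → b ∈ H.support →
      H.Reachable a b := by
    intro a b p
    induction p with
    | nil => intros; exact SimpleGraph.Reachable.refl _
    | @cons a c b hac p ih =>
      intro hp ha hb
      rw [SimpleGraph.Walk.cons_isPath_iff] at hp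
      have hHac : H.Adj a c := by
        obtain ⟨a', ha'⟩ := ha
        obtain ⟨b', hb'⟩ := hb
        by_cases e1 : s(a, a') = s(a, c)
        · rw [← SimpleGraph.mem_edgeSet, ← e1]; exact ha'
        by_cases e2 : s(b, b') = s(c, a)
        · rw [← SimpleGraph.mem_edgeSet, Sym2.eq_swap, ← e2]; exact hb'
        obtain ⟨x1, x2, x3⟩ := (hadj _ _).1 ha'
        obtain ⟨y1, y2, y3⟩ := (hadj _ _).1 hb'
        refine (hadj _ _).2 ⟨hac, ?_, ?_⟩
        · exact heavy_aux T hT.IsAcyclic h f hf x1 x2 x3 e1 (SimpleGraph.Reachable.refl _)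
        · rw [Sym2.eq_swap]
          refine heavy_aux T hT.IsAcyclic h f hf y1 y2 y3 e2 ?_
          exact ⟨p.toDeleteEdge s(c, a)
            (fun he => hp.2 (SimpleGraph.Walk.snd_mem_support_of_mem_edges _ he))⟩
      exact hHac.reachable.trans (ih hp.1 ⟨a, hHac.symm⟩ hb)
  intro a ha b hb
  obtain ⟨p, hp⟩ := (hT.connected a b).exists_isPath
  exact main a b p hp ha hb
end
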